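/- arXiv:2412.04962 — 2 statements merged into one kernel-verified Lean document; each statement's English description precedes it below -/
import Mathlib

section
/- Let H be a hyperplane of T and u ∈ V' with r·u ∉ H, and let Z = {z_1,…,z_q} ⊆ K be a complete set of coset representatives for J in K with z_1 = 0. Then the set of 2e-tuples {σ·(u+h) : σ a unit of K, h ∈ H} ⊆ K^{2e} contains the coset u + T, and it is the disjoint union of the q−1 cosets z_j·u + T for j ∈ {2,…,q}; in particular this set has cardinality (q−1)·q^{2e}. -/
open Matrix

/-- The symplectic form `a M bᵀ` where `M = [[0, Iₑ],[-Iₑ, 0]]`. -/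
def sympForm (K : Type) [CommRing K] (e : ℕ) (a b : Fin e ⊕ Fin e → K) : K :=
  a ⬝ᵥ ((Matrix.fromBlocks (0 : Matrix (Fin e) (Fin e) K) 1 (-1) 0) *ᵥ b)

/-- `V'`: the set of 2e-tuples over `K` having at least one unit entry. -/
def unitTuples (K : Type) [CommRing K] (e : ℕ) : Set (Fin e ⊕ Fin e → K) :=
  {a | ∃ i, IsUnit (a i)}

/-- The equivalence class `[a]` of a tuple under unit scaling. -/
def cls (K : Type) [CommRing K] (e : ℕ) (a : Fin e ⊕ Fin e → K) :
    Set (Fin e ⊕ Fin e → K) :=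
  {b | ∃ σ : Kˣ, b = σ • a}

/-- `V`: the set of equivalence classes of elements of `V'` under unit scaling. -/
def classes (K : Type) [CommRing K] (e : ℕ) : Set (Set (Fin e ⊕ Fin e → K)) :=
  {S | ∃ a ∈ unitTuples K e, S = cls K e a}

/-- Adjacency in the graph `X(2e,K)`: `a M bᵀ ∈ K \ {0}`. -/
def adjX (K : Type) [CommRing K] (e : ℕ) (A B : Set (Fin e ⊕ Fin e → K)) : Prop :=
  ∃ a ∈ A, ∃ b ∈ B, sympForm K e a b ≠ 0

/-- Adjacency in the complement of `X(2e,K)`: distinct classes with `a M bᵀ = 0`. -/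
def adjXc (K : Type) [CommRing K] (e : ℕ) (A B : Set (Fin e ⊕ Fin e → K)) : Prop :=
  A ≠ B ∧ ∃ a ∈ A, ∃ b ∈ B, sympForm K e a b = 0

/-- Adjacency in the graph `Y(2e,K)`: `a M bᵀ ∈ J \ {0}`. -/
def adjY (K : Type) [CommRing K] (J : Ideal K) (e : ℕ)
    (A B : Set (Fin e ⊕ Fin e → K)) : Prop :=
  ∃ a ∈ A, ∃ b ∈ B, sympForm K e a b ∈ J ∧ sympForm K e a b ≠ 0

/-- `T = J × ⋯ × J` (2e factors), as a subset of `K^{2e}`. -/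
def Tset (K : Type) [CommRing K] (J : Ideal K) (e : ℕ) : Set (Fin e ⊕ Fin e → K) :=
  {x | ∀ i, x i ∈ J}

/-- A hyperplane of `T`: a `K`-submodule contained in `T` of cardinality `q^(2e-1)`. -/
def IsHyperplane (K : Type) [CommRing K] (J : Ideal K) (e q : ℕ)
    (H : Submodule K (Fin e ⊕ Fin e → K)) : Prop :=
  (H : Set (Fin e ⊕ Fin e → K)) ⊆ Tset K J e ∧ Nat.card H = q ^ (2 * e - 1)

/-- `C(H,u) = {[u+h] : h ∈ H}`. -/
def classSet (K : Type) [CommRing K] (e : ℕ) (H : Submodule K (Fin e ⊕ Fin e → K))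
    (u : Fin e ⊕ Fin e → K) : Set (Set (Fin e ⊕ Fin e → K)) :=
  {S | ∃ h ∈ (H : Set (Fin e ⊕ Fin e → K)), S = cls K e (u + h)}

/-- The set of tuples `{σ • (u+h) : σ ∈ Kˣ, h ∈ H}`. -/
def orbitSet (K : Type) [CommRing K] (e : ℕ) (H : Submodule K (Fin e ⊕ Fin e → K))
    (u : Fin e ⊕ Fin e → K) : Set (Fin e ⊕ Fin e → K) :=
  {x | ∃ σ : Kˣ, ∃ h ∈ (H : Set (Fin e ⊕ Fin e → K)), x = σ • (u + h)}

/-- The coset `c • u + T` of `T`. -/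
def cosetOf (K : Type) [CommRing K] (J : Ideal K) (e : ℕ) (c : K)
    (u : Fin e ⊕ Fin e → K) : Set (Fin e ⊕ Fin e → K) :=
  {x | ∃ t ∈ Tset K J e, x = c • u + t}

section UniqueIdeal

variable {K : Type} [CommRing K] {J : Ideal K} {r : K}

/-- In a ring with a single nontrivial ideal `J`, every element outside `J` is a unit. -/
lemma isUnit_of_notMem_of_unique_ideal (hideals : ∀ I : Ideal K, I = ⊥ ∨ I = J ∨ I = ⊤)
    {x : K} (hx : x ∉ J) : IsUnit x := by
  rcases hideals (Ideal.span {x}) with h | h | h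
  · rw [Ideal.span_singleton_eq_bot] at h
    exact absurd (h ▸ J.zero_mem) hx
  · exact absurd (h ▸ Ideal.mem_span_singleton_self x) hx
  · exact Ideal.span_singleton_eq_top.mp h

lemma notMem_of_isUnit (hJtop : J ≠ ⊤) {x : K} (hx : IsUnit x) : x ∉ J :=
  fun h => hJtop (J.eq_top_of_isUnit_mem h hx)

/-- The generator of the unique nontrivial ideal squares to zero. -/
lemma generator_mul_self_of_unique_ideal (hJr : J = Ideal.span {r}) (hJtop : J ≠ ⊤)
    (hideals : ∀ I : Ideal K, I = ⊥ ∨ I = J ∨ I = ⊤) : r * r = 0 := by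
  have hr : r ∈ J := hJr ▸ Ideal.mem_span_singleton_self r
  rcases hideals (Ideal.span {r * r}) with h | h | h
  · exact Ideal.span_singleton_eq_bot.mp h
  · obtain ⟨a, ha⟩ := Ideal.mem_span_singleton'.mp (h ▸ hr)
    have hunit : IsUnit (1 - a * r) := isUnit_of_notMem_of_unique_ideal hideals fun hmem =>
      hJtop (J.eq_top_iff_one.mpr (by simpa using J.add_mem hmem (J.mul_mem_left a hr)))
    have : (1 - a * r) * r = 0 := by linear_combination -ha
    rw [hunit.mul_right_eq_zero.mp this, mul_zero]
  · exact absurd (J.mul_mem_left r hr)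
      (notMem_of_isUnit hJtop (Ideal.span_singleton_eq_top.mp h))

lemma generator_mul_eq_zero_of_mem (hJr : J = Ideal.span {r}) (hJtop : J ≠ ⊤)
    (hideals : ∀ I : Ideal K, I = ⊥ ∨ I = J ∨ I = ⊤) {x : K} (hx : x ∈ J) : r * x = 0 := by
  obtain ⟨a, rfl⟩ := Ideal.mem_span_singleton'.mp (hJr ▸ hx)
  linear_combination a * generator_mul_self_of_unique_ideal hJr hJtop hideals

lemma coset_representatives_sub_mem_iff {ι : Type} {z : ι → K}
    (hz : Function.Bijective fun j => Ideal.Quotient.mk J (z j)) (i j : ι) :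
    z i - z j ∈ J ↔ i = j := by
  rw [← Ideal.Quotient.eq]
  exact hz.injective.eq_iff

lemma exists_coset_representative_sub_mem {ι : Type} {z : ι → K}
    (hz : Function.Bijective fun j => Ideal.Quotient.mk J (z j)) (c : K) :
    ∃ j, c - z j ∈ J := by
  obtain ⟨j, hj⟩ := hz.surjective (Ideal.Quotient.mk J c)
  exact ⟨j, Ideal.Quotient.eq.mp hj.symm⟩

/-- Multiplication by the generator puts coset representatives of `J` in bijection with `J`. -/
lemma card_unique_ideal (hJr : J = Ideal.span {r}) (hJbot : J ≠ ⊥) (hJtop : J ≠ ⊤)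
    (hideals : ∀ I : Ideal K, I = ⊥ ∨ I = J ∨ I = ⊤) {ι : Type} {z : ι → K}
    (hz : Function.Bijective fun j => Ideal.Quotient.mk J (z j)) :
    Nat.card J = Nat.card ι := by
  have hr : r ∈ J := hJr ▸ Ideal.mem_span_singleton_self r
  have hr0 : r ≠ 0 := fun h => hJbot (hJr.trans (Ideal.span_singleton_eq_bot.mpr h))
  refine (Nat.card_eq_of_bijective
    (fun j => (⟨r * z j, J.mul_mem_right _ hr⟩ : J)) ⟨fun i j hij => ?_, fun x => ?_⟩).symm
  · by_contra hne
    have hunit : IsUnit (z i - z j) := isUnit_of_notMem_of_unique_ideal hideals fun h =>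
      hne ((coset_representatives_sub_mem_iff hz i j).mp h)
    have : r * z i = r * z j := congrArg Subtype.val hij
    exact hr0 (hunit.mul_left_eq_zero.mp (by rw [mul_sub, this, sub_self]))
  · obtain ⟨c, hc⟩ := Ideal.mem_span_singleton'.mp (hJr.le x.2)
    obtain ⟨j, hj⟩ := exists_coset_representative_sub_mem hz c
    refine ⟨j, Subtype.ext ?_⟩
    change r * z j = x
    linear_combination hc - generator_mul_eq_zero_of_mem hJr hJtop hideals hj

end UniqueIdeal

section Cosets

variable {K : Type} [CommRing K] {J : Ideal K} {e : ℕ}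

lemma Tset_add {x y : Fin e ⊕ Fin e → K} (hx : x ∈ Tset K J e) (hy : y ∈ Tset K J e) :
    x + y ∈ Tset K J e := fun i => J.add_mem (hx i) (hy i)

lemma Tset_smul (c : K) {x : Fin e ⊕ Fin e → K} (hx : x ∈ Tset K J e) :
    c • x ∈ Tset K J e := fun i => J.mul_mem_left c (hx i)

lemma smul_mem_Tset {c : K} (hc : c ∈ J) (x : Fin e ⊕ Fin e → K) :
    c • x ∈ Tset K J e := fun i => J.mul_mem_right (x i) hc

lemma card_Tset : Nat.card (Tset K J e) = Nat.card J ^ (2 * e) := by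
  have : Nat.card (Tset K J e) = Nat.card (Fin e ⊕ Fin e → J) := Nat.card_congr
    (Equiv.subtypePiEquivPi (p := fun (_ : Fin e ⊕ Fin e) (a : K) => a ∈ J))
  rw [this, Nat.card_fun]
  simp [← two_mul]

/-- Two cosets of `T` along a unit tuple meet only if their scalars agree modulo `J`. -/
lemma sub_mem_of_smul_add_eq {u : Fin e ⊕ Fin e → K}
    (hu : u ∈ unitTuples K e) {c c' : K} {t t' : Fin e ⊕ Fin e → K} (ht : t ∈ Tset K J e)
    (ht' : t' ∈ Tset K J e) (h : c • u + t = c' • u + t') : c - c' ∈ J := by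
  obtain ⟨i, hi⟩ := hu
  have hcoord : c * u i + t i = c' * u i + t' i := congrFun h i
  have hmem : (c - c') * u i ∈ J := by
    rw [show (c - c') * u i = t' i - t i by linear_combination hcoord]
    exact J.sub_mem (ht' i) (ht i)
  obtain ⟨v, hv⟩ := hi.exists_right_inv
  rw [show c - c' = (c - c') * u i * v by rw [mul_assoc, hv, mul_one]]
  exact J.mul_mem_right v hmem

variable {r : K} {q : ℕ} {H : Submodule K (Fin e ⊕ Fin e → K)} {u : Fin e ⊕ Fin e → K}

/-- A hyperplane of `T` avoiding `r • u` is complemented in `T` by the multiples of `r • u`. -/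
lemma exists_eq_smul_add_of_mem_Tset [Finite K] (hJr : J = Ideal.span {r}) (hJbot : J ≠ ⊥)
    (hJtop : J ≠ ⊤) (hideals : ∀ I : Ideal K, I = ⊥ ∨ I = J ∨ I = ⊤) (he : e ≠ 0)
    (hH : IsHyperplane K J e q H) (hru : r • u ∉ H) {z : Fin q → K}
    (hz : Function.Bijective fun j => Ideal.Quotient.mk J (z j))
    {t : Fin e ⊕ Fin e → K} (ht : t ∈ Tset K J e) :
    ∃ c : K, ∃ h ∈ H, t = c • r • u + h := by
  have hr : r ∈ J := hJr ▸ Ideal.mem_span_singleton_self r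
  let f : Fin q × H → Tset K J e := fun p =>
    ⟨z p.1 • r • u + p.2, Tset_add (Tset_smul _ (smul_mem_Tset hr u)) (hH.1 p.2.2)⟩
  have hf : Function.Injective f := by
    rintro ⟨i, h⟩ ⟨j, h'⟩ hij
    have heq : z i • r • u + (h : Fin e ⊕ Fin e → K) = z j • r • u + h' :=
      congrArg Subtype.val hij
    obtain rfl : i = j := by
      by_contra hne
      obtain ⟨σ, hσ⟩ : IsUnit (z i - z j) := isUnit_of_notMem_of_unique_ideal hideals fun h =>
        hne ((coset_representatives_sub_mem_iff hz i j).mp h)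
      have hmem : (z i - z j) • r • u ∈ H := by
        have : (z i - z j) • r • u = (h' : Fin e ⊕ Fin e → K) - h := by
          rw [sub_smul, sub_eq_sub_iff_add_eq_add, heq, add_comm]
        rw [this]
        exact H.sub_mem h'.2 h.2
      rw [← hσ] at hmem
      exact hru ((H.smul_mem_iff_of_isUnit σ.isUnit).mp hmem)
    exact Prod.ext rfl (Subtype.ext (add_left_cancel heq))
  have hcard : Nat.card (Fin q × H) = Nat.card (Tset K J e) := by
    rw [Nat.card_prod, hH.2, card_Tset, card_unique_ideal hJr hJbot hJtop hideals hz,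
      Nat.card_fin, ← pow_succ', Nat.sub_add_cancel (by omega)]
  obtain ⟨⟨j, h⟩, hp⟩ := ((Nat.bijective_iff_injective_and_card f).mpr ⟨hf, hcard⟩).surjective
    ⟨t, ht⟩
  exact ⟨z j, h, h.2, (congrArg Subtype.val hp).symm⟩

end Cosets

/-- Lemma: the set of tuples `{σ(u+h) : σ ∈ Kˣ, h ∈ H}` contains the coset `u + T`
and is the disjoint union of the `q-1` cosets `z_j • u + T`, `j ≠ j₀`;
in particular it has cardinality `(q-1)·q^(2e)`. -/
theorem orbitSet_cosets
    (K : Type) [CommRing K] [Fintype K]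
    (J : Ideal K) (r : K) (q : ℕ)
    (hJr : J = Ideal.span {r})
    (hJbot : J ≠ ⊥) (hJtop : J ≠ ⊤)
    (hideals : ∀ I : Ideal K, I = ⊥ ∨ I = J ∨ I = ⊤)
    (hq : IsPrimePow q)
    (hqcard : Nat.card (K ⧸ J) = q)
    (e : ℕ) (he : 2 ≤ e)
    (H : Submodule K (Fin e ⊕ Fin e → K)) (hH : IsHyperplane K J e q H)
    (u : Fin e ⊕ Fin e → K) (hu : u ∈ unitTuples K e) (hru : r • u ∉ H)
    (z : Fin q → K)
    (hz : Function.Bijective fun j => Ideal.Quotient.mk J (z j))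
    (j₀ : Fin q) (hz₀ : z j₀ = 0) :
    (∀ t ∈ Tset K J e, u + t ∈ orbitSet K e H u) ∧
    (orbitSet K e H u = ⋃ j ∈ {j : Fin q | j ≠ j₀}, cosetOf K J e (z j) u) ∧
    (∀ j j' : Fin q, j ≠ j₀ → j' ≠ j₀ → j ≠ j' →
      Disjoint (cosetOf K J e (z j) u) (cosetOf K J e (z j') u)) ∧
    Nat.card (orbitSet K e H u) = (q - 1) * q ^ (2 * e) := by
  have hr : r ∈ J := hJr ▸ Ideal.mem_span_singleton_self r
  have hunit : ∀ j, j ≠ j₀ → IsUnit (z j) := fun j hj =>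
    isUnit_of_notMem_of_unique_ideal hideals fun h =>
      hj ((coset_representatives_sub_mem_iff hz j j₀).mp (by rwa [hz₀, sub_zero]))
  have hcontains : ∀ t ∈ Tset K J e, u + t ∈ orbitSet K e H u := by
    intro t ht
    obtain ⟨c, h, hh, rfl⟩ := exists_eq_smul_add_of_mem_Tset hJr hJbot hJtop hideals
      (by omega) hH hru hz ht
    obtain ⟨σ, hσ⟩ : IsUnit (1 + c * r) := isUnit_of_notMem_of_unique_ideal hideals fun hmem =>
      hJtop (J.eq_top_iff_one.mpr (by simpa using J.sub_mem hmem (J.mul_mem_left c hr)))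
    refine ⟨σ, σ⁻¹ • h, H.smul_mem (↑σ⁻¹ : K) hh, ?_⟩
    rw [smul_add, smul_inv_smul, Units.smul_def, hσ, add_smul, one_smul, mul_smul, add_assoc]
  have hunion : orbitSet K e H u = ⋃ j ∈ {j : Fin q | j ≠ j₀}, cosetOf K J e (z j) u := by
    ext x
    simp only [Set.mem_iUnion, Set.mem_ofPred_eq, exists_prop]
    constructor
    · rintro ⟨σ, h, hh, rfl⟩
      obtain ⟨j, hj⟩ := exists_coset_representative_sub_mem hz (σ : K)
      refine ⟨j, ?_, ((σ : K) - z j) • u + (σ : K) • h,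
        Tset_add (smul_mem_Tset hj u) (Tset_smul _ (hH.1 hh)), ?_⟩
      · rintro rfl
        rw [hz₀, sub_zero] at hj
        exact notMem_of_isUnit hJtop σ.isUnit hj
      · rw [Units.smul_def]
        module
    · rintro ⟨j, hj, t, ht, rfl⟩
      obtain ⟨σ, hσ⟩ := hunit j hj
      obtain ⟨τ, h, hh, hτ⟩ := hcontains _ (Tset_smul (↑σ⁻¹ : K) ht)
      refine ⟨σ * τ, h, hh, ?_⟩
      rw [mul_smul, ← hτ, smul_add, ← Units.smul_def σ⁻¹ t, smul_inv_smul, Units.smul_def, hσ]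
  refine ⟨hcontains, hunion, ?_, ?_⟩
  · intro j j' _ _ hne
    rw [Set.disjoint_left]
    rintro _ ⟨t, ht, rfl⟩ ⟨t', ht', heq⟩
    exact hne ((coset_representatives_sub_mem_iff hz j j').mp
      (sub_mem_of_smul_add_eq hu ht ht' heq))
  · have hmem : ∀ p : {j : Fin q // j ≠ j₀} × Tset K J e,
        z p.1 • u + p.2 ∈ orbitSet K e H u := fun p => by
      rw [hunion]
      exact Set.mem_biUnion p.1.2 ⟨p.2, p.2.2, rfl⟩
    have hbij : Function.Bijective fun p => (⟨_, hmem p⟩ : orbitSet K e H u) := by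
      constructor
      · rintro ⟨⟨i, hi⟩, t⟩ ⟨⟨j, hj⟩, t'⟩ hij
        have heq : z i • u + (t : Fin e ⊕ Fin e → K) = z j • u + t' :=
          congrArg Subtype.val hij
        obtain rfl := (coset_representatives_sub_mem_iff hz i j).mp
          (sub_mem_of_smul_add_eq hu t.2 t'.2 heq)
        exact Prod.ext rfl (Subtype.ext (add_left_cancel heq))
      · rintro ⟨x, hx⟩
        have hx' := hx
        rw [hunion] at hx'
        simp only [Set.mem_iUnion, Set.mem_ofPred_eq, exists_prop] at hx'
        obtain ⟨j, hj, t, ht, rfl⟩ := hx'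
        exact ⟨(⟨j, hj⟩, ⟨t, ht⟩), rfl⟩
    rw [← Nat.card_eq_of_bijective _ hbij, Nat.card_prod, card_Tset,
      card_unique_ideal hJr hJbot hJtop hideals hz, Nat.card_fin]
    simp
end

section
/- Let H be a hyperplane of T and u ∈ V' with r·u ∉ H, and let [a], [b] be two distinct vertices both lying in C(H,u). If [a] and [b] are non-adjacent in the complement of X(2e,K) (i.e., a M bᵀ ≠ 0), then [a] and [b] have exactly (q^{2e-2}−1)·q^{2e-2}/(q−1) common neighbours in the complement of X(2e,K); if [a] and [b] are adjacent in the complement of X(2e,K) (i.e., a M bᵀ = 0), then they have exactly (q^{2e-2}−1)·q^{2e-2}/(q−1) − 2 common neighbours in the complement of X(2e,K). -/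
open Matrix

section SymplecticForm

variable {K : Type} [CommRing K] {e : ℕ}

theorem sympForm_eq_sum (a b : Fin e ⊕ Fin e → K) :
    sympForm K e a b =
      ∑ i, a (Sum.inl i) * b (Sum.inr i) - ∑ i, a (Sum.inr i) * b (Sum.inl i) := by
  simp [sympForm, Matrix.fromBlocks_mulVec, dotProduct, sub_eq_add_neg, Matrix.neg_mulVec]

theorem sympForm_swap (a b : Fin e ⊕ Fin e → K) : sympForm K e b a = -sympForm K e a b := by
  simp only [sympForm_eq_sum, mul_comm (b _), neg_sub]

theorem sympForm_self (a : Fin e ⊕ Fin e → K) : sympForm K e a a = 0 := by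
  simp only [sympForm_eq_sum, mul_comm (a (Sum.inr _)), sub_self]

theorem sympForm_eq_zero_comm {a b : Fin e ⊕ Fin e → K} :
    sympForm K e a b = 0 ↔ sympForm K e b a = 0 := by
  rw [sympForm_swap b a, neg_eq_zero]

theorem sympForm_add_left (a b c : Fin e ⊕ Fin e → K) :
    sympForm K e (a + b) c = sympForm K e a c + sympForm K e b c :=
  add_dotProduct ..

theorem sympForm_smul_left (x : K) (a b : Fin e ⊕ Fin e → K) :
    sympForm K e (x • a) b = x * sympForm K e a b :=
  smul_dotProduct ..

theorem sympForm_smul_right (x : K) (a b : Fin e ⊕ Fin e → K) :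
    sympForm K e a (x • b) = x * sympForm K e a b := by
  rw [sympForm_swap, sympForm_smul_left, sympForm_swap a b, mul_neg, neg_neg]

/-- The symplectic form as a linear functional of its second argument. -/
def sympFunctional (a : Fin e ⊕ Fin e → K) : (Fin e ⊕ Fin e → K) →ₗ[K] K where
  toFun := sympForm K e a
  map_add' b c := by simp only [sympForm, mulVec_add, dotProduct_add]
  map_smul' x b := sympForm_smul_right x a b

theorem sympFunctional_apply (a b : Fin e ⊕ Fin e → K) :
    sympFunctional a b = sympForm K e a b := rfl

theorem exists_sympForm_eq_apply (i : Fin e ⊕ Fin e) :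
    ∃ d : Fin e ⊕ Fin e → K, ∀ x, sympForm K e x d = x i := by
  rcases i with i | i
  · exact ⟨Pi.single (Sum.inr i) 1, fun x => by simp [sympForm_eq_sum, Pi.single_apply]⟩
  · exact ⟨Pi.single (Sum.inl i) (-1), fun x => by simp [sympForm_eq_sum, Pi.single_apply]⟩

theorem exists_sympForm_eq_one {a : Fin e ⊕ Fin e → K} (ha : a ∈ unitTuples K e) :
    ∃ d, sympForm K e a d = 1 := by
  obtain ⟨i, hi⟩ := ha
  obtain ⟨d, hd⟩ := exists_sympForm_eq_apply (K := K) i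
  obtain ⟨x, hx⟩ := hi.exists_left_inv
  exact ⟨x • d, by rw [sympForm_smul_right, hd, hx]⟩

end SymplecticForm

section Classes

variable {K : Type} [CommRing K] {e : ℕ}

theorem mem_cls_self (a : Fin e ⊕ Fin e → K) : a ∈ cls K e a :=
  ⟨1, (one_smul _ _).symm⟩

theorem cls_smul (σ : Kˣ) (a : Fin e ⊕ Fin e → K) : cls K e (σ • a) = cls K e a := by
  ext x
  constructor
  · rintro ⟨τ, rfl⟩
    exact ⟨τ * σ, (mul_smul _ _ _).symm⟩
  · rintro ⟨τ, rfl⟩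
    exact ⟨τ * σ⁻¹, by rw [smul_smul, inv_mul_cancel_right]⟩

theorem smul_mem_unitTuples {a : Fin e ⊕ Fin e → K} (ha : a ∈ unitTuples K e) (σ : Kˣ) :
    σ • a ∈ unitTuples K e :=
  ha.imp fun i hi => by simpa [Units.smul_def] using σ.isUnit.mul hi

theorem sympForm_units_smul_smul_eq_zero (σ τ : Kˣ) (a b : Fin e ⊕ Fin e → K) :
    sympForm K e (σ • a) (τ • b) = 0 ↔ sympForm K e a b = 0 := by
  simp only [Units.smul_def, sympForm_smul_left, sympForm_smul_right, Units.mul_right_eq_zero]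

theorem adjXc_cls_cls (a b : Fin e ⊕ Fin e → K) :
    adjXc K e (cls K e a) (cls K e b) ↔ cls K e a ≠ cls K e b ∧ sympForm K e a b = 0 := by
  refine and_congr_right fun _ => ⟨?_, fun h => ⟨a, mem_cls_self a, b, mem_cls_self b, h⟩⟩
  rintro ⟨_, ⟨σ, rfl⟩, _, ⟨τ, rfl⟩, h⟩
  exact (sympForm_units_smul_smul_eq_zero σ τ a b).1 h

/-- A set of unit tuples stable under unit scaling splits into classes of size `|Kˣ|`. -/
theorem ncard_image_cls_mul [Finite K] {S : Set (Fin e ⊕ Fin e → K)} (hS : S ⊆ unitTuples K e)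
    (hsmul : ∀ σ : Kˣ, ∀ c ∈ S, σ • c ∈ S) :
    (cls K e '' S).ncard * Nat.card Kˣ = S.ncard := by
  choose f hfS hf using fun C : cls K e '' S => C.2
  rw [← Nat.card_coe_set_eq, ← Nat.card_coe_set_eq, ← Nat.card_prod]
  refine Nat.card_congr (Equiv.ofBijective
    (fun p => ⟨p.2 • f p.1, hsmul p.2 _ (hfS p.1)⟩) ⟨?_, ?_⟩)
  · rintro ⟨C, σ⟩ ⟨D, τ⟩ h
    have h' : σ • f C = τ • f D := congrArg Subtype.val h
    have hCD : C = D := by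
      refine Subtype.ext ?_
      rw [← hf C, ← hf D, ← cls_smul σ, h', cls_smul]
    subst hCD
    obtain ⟨i, hi⟩ := hS (hfS C)
    have hi' : (σ : K) * f C i = τ * f C i := congrFun h' i
    rw [Units.ext (hi.mul_right_cancel hi')]
  · rintro ⟨c, hc⟩
    have hmem : c ∈ cls K e (f ⟨cls K e c, c, hc, rfl⟩) := by
      rw [hf]
      exact mem_cls_self c
    obtain ⟨σ, hσ⟩ := hmem
    exact ⟨(⟨cls K e c, c, hc, rfl⟩, σ), Subtype.ext hσ.symm⟩

end Classes

theorem LinearMap.natCard_ker_mul_of_surjective {R M N : Type*} [Ring R] [AddCommGroup M]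
    [AddCommGroup N] [Module R M] [Module R N] {f : M →ₗ[R] N} (hf : Function.Surjective f) :
    Nat.card f.ker * Nat.card N = Nat.card M := by
  rw [Submodule.card_eq_card_quotient_mul_card f.ker,
    Nat.card_congr (f.quotKerEquivOfSurjective hf).toEquiv, mul_comm]

section UniqueIdeal

variable {K : Type} [CommRing K] {J : Ideal K} {r : K}

theorem isUnit_iff_notMem_of_unique_ideal (hJtop : J ≠ ⊤)
    (hideals : ∀ I : Ideal K, I = ⊥ ∨ I = J ∨ I = ⊤) (x : K) : IsUnit x ↔ x ∉ J := by
  refine ⟨fun hx hxJ => hJtop (Ideal.eq_top_of_isUnit_mem _ hxJ hx), fun hx => ?_⟩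
  rw [← Ideal.span_singleton_eq_top]
  rcases hideals (Ideal.span {x}) with h | h | h
  · rw [Ideal.span_singleton_eq_bot] at h
    exact absurd (h ▸ J.zero_mem) hx
  · exact absurd (h ▸ Ideal.mem_span_singleton_self x) hx
  · exact h

theorem generator_mul_eq_zero_iff (hJr : J = Ideal.span {r}) (hJbot : J ≠ ⊥) (hJtop : J ≠ ⊤)
    (hideals : ∀ I : Ideal K, I = ⊥ ∨ I = J ∨ I = ⊤) (x : K) : r * x = 0 ↔ x ∈ J := by
  have hunit := isUnit_iff_notMem_of_unique_ideal hJtop hideals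
  have hr0 : r ≠ 0 := fun h => hJbot (by rw [hJr, h, Ideal.span_singleton_eq_bot])
  have hrJ : r ∈ J := hJr ▸ Ideal.mem_span_singleton_self r
  have hrr : r * r = 0 := by
    rcases hideals (Ideal.span {r * r}) with h | h | h
    · rwa [Ideal.span_singleton_eq_bot] at h
    · obtain ⟨s, hs⟩ := Ideal.mem_span_singleton'.1 (h ▸ hrJ)
      have hu : IsUnit (1 - s * r) := (hunit _).2 fun hmem =>
        hJtop ((Ideal.eq_top_iff_one J).2 (by simpa using J.add_mem hmem (J.mul_mem_left s hrJ)))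
      exact absurd (hu.mul_left_eq_zero.1 (by linear_combination -hs)) hr0
    · exact absurd ((Ideal.span_singleton_eq_top.1 h)) fun hu =>
        (hunit _).1 (isUnit_of_mul_isUnit_left hu) hrJ
  constructor
  · intro h
    by_contra hx
    exact hr0 (((hunit x).2 hx).mul_left_eq_zero.1 h)
  · intro hx
    rw [hJr] at hx
    obtain ⟨s, rfl⟩ := Ideal.mem_span_singleton'.1 hx
    linear_combination s * hrr

theorem natCard_ideal_eq_natCard_quotient (hJr : J = Ideal.span {r}) (hJbot : J ≠ ⊥)
    (hJtop : J ≠ ⊤) (hideals : ∀ I : Ideal K, I = ⊥ ∨ I = J ∨ I = ⊤) :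
    Nat.card J = Nat.card (K ⧸ J) := by
  have hker : (LinearMap.toSpanSingleton K K r).ker = J := by
    ext x
    rw [LinearMap.mem_ker, LinearMap.toSpanSingleton_apply, smul_eq_mul, mul_comm,
      generator_mul_eq_zero_iff hJr hJbot hJtop hideals]
  have hrange : (LinearMap.toSpanSingleton K K r).range = J := by
    rw [LinearMap.range_toSpanSingleton, hJr]
  have := Nat.card_congr (LinearMap.toSpanSingleton K K r).quotKerEquivRange.toEquiv
  rw [hker, hrange] at this
  exact this.symm

variable {e q : ℕ}

theorem natCard_eq_sq_of_unique_ideal (hJr : J = Ideal.span {r}) (hJbot : J ≠ ⊥)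
    (hJtop : J ≠ ⊤) (hideals : ∀ I : Ideal K, I = ⊥ ∨ I = J ∨ I = ⊤)
    (hq : Nat.card (K ⧸ J) = q) : Nat.card K = q * q := by
  rw [Submodule.card_eq_card_quotient_mul_card J,
    natCard_ideal_eq_natCard_quotient hJr hJbot hJtop hideals, hq]

theorem natCard_units_add_of_unique_ideal [Finite K] (hJr : J = Ideal.span {r}) (hJbot : J ≠ ⊥)
    (hJtop : J ≠ ⊤) (hideals : ∀ I : Ideal K, I = ⊥ ∨ I = J ∨ I = ⊤)
    (hq : Nat.card (K ⧸ J) = q) : Nat.card Kˣ + q = q * q := by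
  have hset : Set.range (Units.val : Kˣ → K) = (J : Set K)ᶜ := by
    ext x
    exact isUnit_iff_notMem_of_unique_ideal hJtop hideals x
  rw [← natCard_eq_sq_of_unique_ideal hJr hJbot hJtop hideals hq,
    ← Set.ncard_add_ncard_compl (J : Set K), ← hset, ← Nat.card_coe_set_eq (Set.range _),
    Nat.card_range_of_injective Units.val_injective, add_comm, ← Nat.card_coe_set_eq, ← hq,
    ← natCard_ideal_eq_natCard_quotient hJr hJbot hJtop hideals]
  rfl

/-- The tuples orthogonal to `a` and, modulo `J`, to `w`. -/
def orthogonalSubmodule (J : Ideal K) (a w : Fin e ⊕ Fin e → K) :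
    Submodule K (Fin e ⊕ Fin e → K) :=
  ((sympFunctional a).prod (J.mkQ ∘ₗ sympFunctional w)).ker

theorem mem_orthogonalSubmodule {a w c : Fin e ⊕ Fin e → K} :
    c ∈ orthogonalSubmodule J a w ↔ sympForm K e a c = 0 ∧ sympForm K e w c ∈ J := by
  simp [orthogonalSubmodule, sympFunctional_apply, Ideal.Quotient.eq_zero_iff_mem]

theorem natCard_orthogonalSubmodule_mul {a w d : Fin e ⊕ Fin e → K} (ha : a ∈ unitTuples K e)
    (had : sympForm K e a d = 0) (hwd : IsUnit (sympForm K e w d)) :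
    Nat.card (orthogonalSubmodule J a w) * (Nat.card K * Nat.card (K ⧸ J)) =
      Nat.card K ^ (2 * e) := by
  have hsurj : Function.Surjective ((sympFunctional a).prod (J.mkQ ∘ₗ sympFunctional w)) := by
    rintro ⟨x, y⟩
    obtain ⟨y, rfl⟩ := J.mkQ_surjective y
    obtain ⟨d₁, hd₁⟩ := exists_sympForm_eq_one ha
    obtain ⟨v, hv⟩ := hwd.exists_left_inv
    refine ⟨x • d₁ + ((y - x * sympForm K e w d₁) * v) • d, Prod.ext ?_ ?_⟩
    · have : sympFunctional a (x • d₁ + ((y - x * sympForm K e w d₁) * v) • d) = x := by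
        simp only [map_add, map_smul, sympFunctional_apply, smul_eq_mul, hd₁, had, mul_one,
          mul_zero, add_zero]
      exact this
    · have : sympFunctional w (x • d₁ + ((y - x * sympForm K e w d₁) * v) • d) = y := by
        simp only [map_add, map_smul, sympFunctional_apply, smul_eq_mul]
        linear_combination (y - x * sympForm K e w d₁) * hv
      exact congrArg J.mkQ this
  rw [← Nat.card_prod, orthogonalSubmodule, LinearMap.natCard_ker_mul_of_surjective hsurj,
    Nat.card_fun, Nat.card_sum, Nat.card_fin, two_mul]

theorem ncard_Tset : (Tset K J e).ncard = Nat.card J ^ (2 * e) := by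
  let E : Tset K J e ≃ (Fin e ⊕ Fin e → J) := Equiv.subtypePiEquivPi
  rw [← Nat.card_coe_set_eq, Nat.card_congr E, Nat.card_fun, Nat.card_sum, Nat.card_fin, two_mul]

theorem sympForm_mem_of_mem_Tset {c : Fin e ⊕ Fin e → K} (a : Fin e ⊕ Fin e → K)
    (hc : c ∈ Tset K J e) : sympForm K e a c ∈ J := by
  rw [sympForm_eq_sum]
  exact J.sub_mem (J.sum_mem fun i _ => J.mul_mem_left _ (hc _))
    (J.sum_mem fun i _ => J.mul_mem_left _ (hc _))

theorem ncard_orthogonalSubmodule_inter_Tset_mul {a : Fin e ⊕ Fin e → K}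
    (ha : a ∈ unitTuples K e) (w : Fin e ⊕ Fin e → K) :
    ((orthogonalSubmodule J a w : Set (Fin e ⊕ Fin e → K)) ∩ Tset K J e).ncard * Nat.card J =
      Nat.card J ^ (2 * e) := by
  let T : Submodule K (Fin e ⊕ Fin e → K) := Submodule.pi Set.univ fun _ => J
  have hT (c) : c ∈ T ↔ c ∈ Tset K J e := by simp [T, Tset]
  let f : T →ₗ[K] J := (sympFunctional a).restrict fun c hc =>
    sympForm_mem_of_mem_Tset a ((hT c).1 hc)
  have hf : Function.Surjective f := by
    rintro ⟨x, hx⟩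
    obtain ⟨d, hd⟩ := exists_sympForm_eq_one ha
    refine ⟨⟨x • d, (hT _).2 fun i => J.mul_mem_right _ hx⟩, Subtype.ext ?_⟩
    change sympForm K e a (x • d) = x
    rw [sympForm_smul_right, hd, mul_one]
  have hset : (orthogonalSubmodule J a w : Set (Fin e ⊕ Fin e → K)) ∩ Tset K J e =
      (f.ker.map T.subtype : Submodule K _) := by
    ext c
    simp only [Set.mem_inter_iff, SetLike.mem_coe, mem_orthogonalSubmodule, Submodule.mem_map,
      LinearMap.mem_ker]
    constructor
    · rintro ⟨⟨h, -⟩, hc⟩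
      exact ⟨⟨c, (hT c).2 hc⟩, Subtype.ext h, rfl⟩
    · rintro ⟨⟨c, hc⟩, h, rfl⟩
      exact ⟨⟨congrArg Subtype.val h, sympForm_mem_of_mem_Tset w ((hT c).1 hc)⟩, (hT c).1 hc⟩
  have hcard : (f.ker.map T.subtype : Set (Fin e ⊕ Fin e → K)).ncard = Nat.card f.ker := by
    rw [Submodule.map_coe, Set.ncard_image_of_injective _ T.injective_subtype,
      ← Nat.card_coe_set_eq]
    rfl
  rw [hset, hcard, LinearMap.natCard_ker_mul_of_surjective hf, ← ncard_Tset,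
    ← Nat.card_coe_set_eq]
  exact Nat.card_congr (Equiv.subtypeEquivRight hT)

theorem exists_sympForm_eq_zero_isUnit (hJr : J = Ideal.span {r}) (hJbot : J ≠ ⊥) (hJtop : J ≠ ⊤)
    (hideals : ∀ I : Ideal K, I = ⊥ ∨ I = J ∨ I = ⊤) {H : Submodule K (Fin e ⊕ Fin e → K)}
    {a w : Fin e ⊕ Fin e → K} (ha : a ∈ unitTuples K e) (hra : r • a ∉ H) (hrw : r • w ∈ H)
    (hrw0 : r • w ≠ 0) : ∃ d, sympForm K e a d = 0 ∧ IsUnit (sympForm K e w d) := by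
  have hunit := isUnit_iff_notMem_of_unique_ideal hJtop hideals
  have hann := generator_mul_eq_zero_iff hJr hJbot hJtop hideals
  obtain ⟨i, hi⟩ := ha
  obtain ⟨v, hv⟩ := hi.exists_left_inv
  choose d hd using exists_sympForm_eq_apply (K := K) (e := e)
  by_contra! hnone
  have hmem (j) : w j - a j * v * w i ∈ J := by
    by_contra hj
    refine hnone (d j - (a j * v) • d i) ?_ ?_
    · rw [← sympFunctional_apply, map_sub, map_smul, sympFunctional_apply, sympFunctional_apply,
        hd, hd, smul_eq_mul]
      linear_combination -a j * hv
    · rwa [← sympFunctional_apply, map_sub, map_smul, sympFunctional_apply, sympFunctional_apply,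
        hd, hd, smul_eq_mul, hunit]
  have hrw' : r • w = (v * w i) • r • a := by
    ext j
    simp only [Pi.smul_apply, smul_eq_mul]
    linear_combination (hann _).2 (hmem j)
  by_cases hwi : v * w i ∈ J
  · refine hrw0 (hrw'.trans ?_)
    rw [smul_smul, mul_comm, (hann _).2 hwi, zero_smul]
  · obtain ⟨x, hx⟩ := ((hunit _).2 hwi).exists_left_inv
    refine hra ?_
    have := H.smul_mem x hrw
    rwa [hrw', smul_smul, hx, one_smul] at this

/-- The unit tuples orthogonal to both `a` and `b`. -/
def commonOrthogonal (a b : Fin e ⊕ Fin e → K) : Set (Fin e ⊕ Fin e → K) :=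
  {c ∈ unitTuples K e | sympForm K e c a = 0 ∧ sympForm K e c b = 0}

theorem ncard_image_cls_commonOrthogonal_mul [Finite K] (hJr : J = Ideal.span {r})
    (hJbot : J ≠ ⊥) (hJtop : J ≠ ⊤) (hideals : ∀ I : Ideal K, I = ⊥ ∨ I = J ∨ I = ⊤)
    (hq : 0 < q) (hqcard : Nat.card (K ⧸ J) = q) (he : 2 ≤ e)
    {H : Submodule K (Fin e ⊕ Fin e → K)} {a w : Fin e ⊕ Fin e → K} (ha : a ∈ unitTuples K e)
    (hra : r • a ∉ H) (hrw : r • w ∈ H) (hrw0 : r • w ≠ 0) :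
    (cls K e '' commonOrthogonal a (a + r • w)).ncard * (q - 1) =
      (q ^ (2 * e - 2) - 1) * q ^ (2 * e - 2) := by
  have hunit := isUnit_iff_notMem_of_unique_ideal hJtop hideals
  obtain ⟨d, had, hwd⟩ := exists_sympForm_eq_zero_isUnit hJr hJbot hJtop hideals ha hra hrw hrw0
  have hL := natCard_orthogonalSubmodule_mul (J := J) ha had hwd
  have hT := ncard_orthogonalSubmodule_inter_Tset_mul (J := J) ha w
  have hU := natCard_units_add_of_unique_ideal hJr hJbot hJtop hideals hqcard
  have hset : commonOrthogonal a (a + r • w) =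
      (orthogonalSubmodule J a w : Set (Fin e ⊕ Fin e → K)) \ Tset K J e := by
    ext c
    have hc : c ∈ unitTuples K e ↔ c ∉ Tset K J e := by
      simp only [unitTuples, Tset, hunit, Set.mem_ofPred_eq, not_forall]
    simp only [commonOrthogonal, Set.mem_ofPred_eq, hc, Set.mem_sdiff, SetLike.mem_coe,
      mem_orthogonalSubmodule, sympForm_eq_zero_comm (a := c), sympForm_add_left,
      sympForm_smul_left, ← generator_mul_eq_zero_iff hJr hJbot hJtop hideals]
    constructor
    · rintro ⟨h, h₁, h₂⟩
      exact ⟨⟨h₁, by rwa [h₁, zero_add] at h₂⟩, h⟩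
    · rintro ⟨⟨h₁, h₂⟩, h⟩
      exact ⟨h, h₁, by rw [h₁, h₂, zero_add]⟩
  have hcls := ncard_image_cls_mul (S := commonOrthogonal a (a + r • w)) (fun c hc => hc.1)
    (by
      rintro σ c ⟨hc, h₁, h₂⟩
      refine ⟨smul_mem_unitTuples hc σ, ?_, ?_⟩ <;>
        simp only [Units.smul_def, sympForm_smul_left, h₁, h₂, mul_zero])
  have hdiff := Set.ncard_inter_add_ncard_sdiff_eq_ncard
    (orthogonalSubmodule J a w : Set (Fin e ⊕ Fin e → K)) (Tset K J e) (Set.toFinite _)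
  rw [← hset, ← hcls] at hdiff
  rw [natCard_eq_sq_of_unique_ideal hJr hJbot hJtop hideals hqcard, hqcard] at hL
  rw [natCard_ideal_eq_natCard_quotient hJr hJbot hJtop hideals, hqcard] at hT
  obtain ⟨m, hm⟩ : ∃ m, 2 * e = m + 2 := ⟨2 * e - 2, by omega⟩
  obtain ⟨p, rfl⟩ : ∃ p, q = p + 1 := ⟨q - 1, by omega⟩
  have hU' : Nat.card Kˣ = (p + 1) * p := by linarith
  rw [hm] at hL hT ⊢
  rw [hU'] at hdiff
  simp only [Nat.add_sub_cancel]
  have hT' : ((orthogonalSubmodule J a w : Set (Fin e ⊕ Fin e → K)) ∩ Tset K J e).ncard =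
      (p + 1) ^ (m + 1) :=
    Nat.eq_of_mul_eq_mul_right hq (by rw [hT, pow_succ])
  have hL' : Nat.card (orthogonalSubmodule J a w) = (p + 1) ^ (2 * m + 1) :=
    Nat.eq_of_mul_eq_mul_right (Nat.pow_pos hq : 0 < (p + 1) ^ 3) (by
      rw [← pow_add]
      calc _ = _ := by ring
        _ = _ := hL
        _ = _ := by
          rw [← sq, ← pow_mul]
          ring)
  rw [hT'] at hdiff
  rw [Nat.sub_mul, one_mul]
  refine Nat.eq_sub_of_add_eq (Nat.eq_of_mul_eq_mul_right hq ?_)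
  have hdiff' := hdiff.trans ((Nat.card_coe_set_eq _).symm.trans hL')
  calc _ = _ := by ring
    _ = _ := hdiff'
    _ = _ := by ring

end UniqueIdeal

theorem setOf_common_neighbours_eq {K : Type} [CommRing K] {e : ℕ} (a b : Fin e ⊕ Fin e → K) :
    {C ∈ classes K e | adjXc K e C (cls K e a) ∧ adjXc K e C (cls K e b)} =
      (cls K e '' commonOrthogonal a b) \ {cls K e a, cls K e b} := by
  ext C
  simp only [Set.mem_ofPred_eq, Set.mem_sdiff, Set.mem_insert_iff, Set.mem_singleton_iff, not_or]
  constructor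
  · rintro ⟨⟨c, hc, rfl⟩, h₁, h₂⟩
    rw [adjXc_cls_cls] at h₁ h₂
    exact ⟨⟨c, ⟨hc, h₁.2, h₂.2⟩, rfl⟩, h₁.1, h₂.1⟩
  · rintro ⟨⟨c, ⟨hc, h₁, h₂⟩, rfl⟩, ha, hb⟩
    exact ⟨⟨c, hc, rfl⟩, (adjXc_cls_cls c a).2 ⟨ha, h₁⟩, (adjXc_cls_cls c b).2 ⟨hb, h₂⟩⟩

theorem cls_mem_image_commonOrthogonal {K : Type} [CommRing K] {e : ℕ}
    {a b c : Fin e ⊕ Fin e → K} (hc : c ∈ unitTuples K e) :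
    cls K e c ∈ cls K e '' commonOrthogonal a b ↔
      sympForm K e c a = 0 ∧ sympForm K e c b = 0 := by
  refine ⟨?_, fun h => ⟨c, ⟨hc, h⟩, rfl⟩⟩
  rintro ⟨x, ⟨-, h₁, h₂⟩, hx⟩
  obtain ⟨σ, rfl⟩ : c ∈ cls K e x := hx ▸ mem_cls_self c
  simp only [Units.smul_def, sympForm_smul_left, h₁, h₂, mul_zero, and_self]

/-- Proposition: common neighbours in the complement of `X(2e,K)` of two distinct
vertices from the same class `C(H,u)`. -/
theorem common_neighbours_complement_X_same_class
    (K : Type) [CommRing K] [Fintype K]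
    (J : Ideal K) (r : K) (q : ℕ)
    (hJr : J = Ideal.span {r})
    (hJbot : J ≠ ⊥) (hJtop : J ≠ ⊤)
    (hideals : ∀ I : Ideal K, I = ⊥ ∨ I = J ∨ I = ⊤)
    (hq : IsPrimePow q)
    (hqcard : Nat.card (K ⧸ J) = q)
    (e : ℕ) (he : 2 ≤ e)
    (H : Submodule K (Fin e ⊕ Fin e → K)) (hH : IsHyperplane K J e q H)
    (u : Fin e ⊕ Fin e → K) (hu : u ∈ unitTuples K e) (hru : r • u ∉ H)
    (a b : Fin e ⊕ Fin e → K)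
    (ha : a ∈ unitTuples K e) (hb : b ∈ unitTuples K e)
    (haC : cls K e a ∈ classSet K e H u) (hbC : cls K e b ∈ classSet K e H u)
    (hab : cls K e a ≠ cls K e b) :
    (sympForm K e a b ≠ 0 →
      Nat.card ↥{C ∈ classes K e | adjXc K e C (cls K e a) ∧ adjXc K e C (cls K e b)} =
        (q ^ (2 * e - 2) - 1) * q ^ (2 * e - 2) / (q - 1)) ∧
    (sympForm K e a b = 0 →
      Nat.card ↥{C ∈ classes K e | adjXc K e C (cls K e a) ∧ adjXc K e C (cls K e b)} =
        (q ^ (2 * e - 2) - 1) * q ^ (2 * e - 2) / (q - 1) - 2) := by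
  obtain ⟨h₁, hh₁, hA⟩ := haC
  obtain ⟨h₂, hh₂, hB⟩ := hbC
  obtain ⟨σ, hσ⟩ : u + h₁ ∈ cls K e a := hA ▸ mem_cls_self (u + h₁)
  obtain ⟨τ, hτ⟩ : u + h₂ ∈ cls K e b := hB ▸ mem_cls_self (u + h₂)
  have ha' : u + h₁ ∈ unitTuples K e := hσ ▸ smul_mem_unitTuples ha σ
  have hb' : u + h₂ ∈ unitTuples K e := hτ ▸ smul_mem_unitTuples hb τ
  have hform : sympForm K e a b = 0 ↔ sympForm K e (u + h₁) (u + h₂) = 0 := by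
    rw [hσ, hτ, sympForm_units_smul_smul_eq_zero]
  obtain ⟨w, hw⟩ : ∃ w : Fin e ⊕ Fin e → K, h₂ - h₁ = r • w := by
    have h (i) : ∃ x, x * r = (h₂ - h₁) i :=
      Ideal.mem_span_singleton'.1 (hJr ▸ J.sub_mem (hH.1 hh₂ i) (hH.1 hh₁ i))
    choose w hw using h
    exact ⟨w, funext fun i => by rw [← hw, Pi.smul_apply, smul_eq_mul, mul_comm]⟩
  have hab' : u + h₂ = (u + h₁) + r • w := by
    rw [← hw]
    abel
  have hrh₁ : r • h₁ = 0 := funext fun i =>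
    (generator_mul_eq_zero_iff hJr hJbot hJtop hideals _).2 (hH.1 hh₁ i)
  rw [hA, hB] at hab
  have hcard := ncard_image_cls_commonOrthogonal_mul hJr hJbot hJtop hideals hq.pos hqcard he
    (H := H) (a := u + h₁) (w := w) ha' (by rwa [smul_add, hrh₁, add_zero])
    (hw ▸ H.sub_mem hh₂ hh₁) (fun h => hab (by rw [hab', h, add_zero]))
  rw [← hab'] at hcard
  rw [ne_eq, hform, hA, hB, setOf_common_neighbours_eq, Nat.card_coe_set_eq, ← hcard,
    Nat.mul_div_cancel _ (Nat.sub_pos_of_lt hq.one_lt)]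
  constructor
  · intro h
    rw [sdiff_eq_left.2]
    rw [Set.disjoint_right]
    rintro C (rfl | rfl)
    · rw [cls_mem_image_commonOrthogonal ha']
      exact fun h' => h h'.2
    · rw [cls_mem_image_commonOrthogonal hb']
      exact fun h' => h (sympForm_eq_zero_comm.1 h'.1)
  · intro h
    rw [Set.ncard_sdiff, Set.ncard_pair hab]
    rintro C (rfl | rfl)
    · exact (cls_mem_image_commonOrthogonal ha').2 ⟨sympForm_self _, h⟩
    · exact (cls_mem_image_commonOrthogonal hb').2 ⟨sympForm_eq_zero_comm.1 h, sympForm_self _⟩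
end
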